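/- In the BWA rating setup, for every λ ∈ [0, 1/(1 + Δ)) and Δ > 0, the composite BWA map T on ranking vectors with entries in [R_⊥, R_⊤], T(r)_j = (Σ_i R_{ij} · c_i(r)) / (Σ_i c_i(r)), has a unique fixed point r* with entries in [R_⊥, R_⊤], and the BWA ranking iterates r^{k+1} = T(r^k) converge to r* from any starting ranking vector with entries in [R_⊥, R_⊤]. -/

import Mathlib

open Finset Filter Topology

/-- BWA reputation update. -/
noncomputable def bwaRep {N M : ℕ} (R : Fin N → Fin M → ℝ) (lam : ℝ) (r : Fin M → ℝ)
    (i : Fin N) : ℝ :=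
  1 - (lam / M) * ∑ j, |R i j - r j|

/-- Composite BWA map on ranking vectors. -/
noncomputable def bwaT {N M : ℕ} (R : Fin N → Fin M → ℝ) (lam : ℝ) (r : Fin M → ℝ)
    (j : Fin M) : ℝ :=
  (∑ i, R i j * bwaRep R lam r i) / (∑ i, bwaRep R lam r i)

lemma bwaRep_lower {N M : ℕ} (hM : 1 ≤ M) (Rbot Rtop : ℝ)
    (R : Fin N → Fin M → ℝ) (hR : ∀ (i : Fin N) (j : Fin M), Rbot ≤ R i j ∧ R i j ≤ Rtop)
    (lam : ℝ) (hlam0 : 0 ≤ lam) (r : Fin M → ℝ) (hr : ∀ j, Rbot ≤ r j ∧ r j ≤ Rtop)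
    (i : Fin N) : 1 - lam * (Rtop - Rbot) ≤ bwaRep R lam r i := by
  unfold bwaRep
  have hM' : (0 : ℝ) < M := by exact_mod_cast hM
  have h1 : ∑ j, |R i j - r j| ≤ M * (Rtop - Rbot) := by
    calc ∑ j, |R i j - r j| ≤ ∑ _j : Fin M, (Rtop - Rbot) := by
          apply Finset.sum_le_sum
          intro j _
          rw [abs_le]
          constructor <;> linarith [hR i j, hr j, (hR i j).1, (hR i j).2, (hr j).1, (hr j).2]
      _ = M * (Rtop - Rbot) := by simp; ring
  have h2 : lam / M * ∑ j, |R i j - r j| ≤ lam / M * (M * (Rtop - Rbot)) :=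
    mul_le_mul_of_nonneg_left h1 (by positivity)
  have h3 : lam / M * (M * (Rtop - Rbot)) = lam * (Rtop - Rbot) := by
    field_simp
  linarith

lemma bwaRep_lip {N M : ℕ} (hM : 1 ≤ M)
    (R : Fin N → Fin M → ℝ)
    (lam : ℝ) (hlam0 : 0 ≤ lam) (r s : Fin M → ℝ)
    (i : Fin N) : |bwaRep R lam r i - bwaRep R lam s i| ≤ lam * dist r s := by
  unfold bwaRep
  have hM' : (0 : ℝ) < M := by exact_mod_cast hM
  have h0 : (1 - lam / M * ∑ j, |R i j - r j|) - (1 - lam / M * ∑ j, |R i j - s j|)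
      = lam / M * ∑ j, (|R i j - s j| - |R i j - r j|) := by
    rw [Finset.sum_sub_distrib]; ring
  rw [h0, abs_mul, abs_of_nonneg (by positivity : 0 ≤ lam / M)]
  have h1 : |∑ j, (|R i j - s j| - |R i j - r j|)| ≤ M * dist r s := by
    calc |∑ j, (|R i j - s j| - |R i j - r j|)|
        ≤ ∑ j, |(|R i j - s j| - |R i j - r j|)| := Finset.abs_sum_le_sum_abs _ _
      _ ≤ ∑ _j : Fin M, dist r s := by
          apply Finset.sum_le_sum
          intro j _
          refine (abs_abs_sub_abs_le _ _).trans ?_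
          have := dist_le_pi_dist r s j
          rw [Real.dist_eq] at this
          have e : R i j - s j - (R i j - r j) = r j - s j := by ring
          rw [e]; exact this
      _ = M * dist r s := by simp
  calc _ ≤ lam / M * (M * dist r s) := mul_le_mul_of_nonneg_left h1 (by positivity)
    _ = _ := by field_simp

lemma bwaT_mem {N M : ℕ} (hN : 1 ≤ N) (Rbot Rtop : ℝ)
    (R : Fin N → Fin M → ℝ) (hR : ∀ (i : Fin N) (j : Fin M), Rbot ≤ R i j ∧ R i j ≤ Rtop)
    (lam : ℝ) (r : Fin M → ℝ) (hc : ∀ i, 0 < bwaRep R lam r i) (j : Fin M) :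
    Rbot ≤ bwaT R lam r j ∧ bwaT R lam r j ≤ Rtop := by
  have : Nonempty (Fin N) := ⟨⟨0, hN⟩⟩
  have hS : 0 < ∑ i, bwaRep R lam r i := Finset.sum_pos (fun i _ => hc i) Finset.univ_nonempty
  unfold bwaT
  rw [le_div_iff₀ hS, div_le_iff₀ hS, Finset.mul_sum, Finset.mul_sum]
  exact ⟨Finset.sum_le_sum fun i _ => mul_le_mul_of_nonneg_right (hR i j).1 (hc i).le,
    Finset.sum_le_sum fun i _ => mul_le_mul_of_nonneg_right (hR i j).2 (hc i).le⟩

lemma bwaT_lip {N M : ℕ} (hN : 1 ≤ N) (hM : 1 ≤ M) (Rbot Rtop : ℝ) (hΔ : 0 < Rtop - Rbot)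
    (R : Fin N → Fin M → ℝ) (hR : ∀ (i : Fin N) (j : Fin M), Rbot ≤ R i j ∧ R i j ≤ Rtop)
    (lam : ℝ) (hlam0 : 0 ≤ lam) (hp : 0 < 1 - lam * (Rtop - Rbot)) (r s : Fin M → ℝ)
    (hr : ∀ j, Rbot ≤ r j ∧ r j ≤ Rtop) (hs : ∀ j, Rbot ≤ s j ∧ s j ≤ Rtop) :
    dist (bwaT R lam r) (bwaT R lam s) ≤
      lam * (Rtop - Rbot) / (1 - lam * (Rtop - Rbot)) * dist r s := by
  have : Nonempty (Fin N) := ⟨⟨0, hN⟩⟩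
  have hN' : (0 : ℝ) < N := by exact_mod_cast hN
  have hcr := bwaRep_lower hM Rbot Rtop R hR lam hlam0 r hr
  have hcs := bwaRep_lower hM Rbot Rtop R hR lam hlam0 s hs
  have hSr : N * (1 - lam * (Rtop - Rbot)) ≤ ∑ i, bwaRep R lam r i := by
    calc N * (1 - lam * (Rtop - Rbot)) = ∑ _i : Fin N, (1 - lam * (Rtop - Rbot)) := by
          simp; ring
      _ ≤ _ := Finset.sum_le_sum fun i _ => hcr i
  have hSr0 : 0 < ∑ i, bwaRep R lam r i := lt_of_lt_of_le (by positivity) hSr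
  have hSs0 : 0 < ∑ i, bwaRep R lam s i :=
    Finset.sum_pos (fun i _ => hp.trans_le (hcs i)) Finset.univ_nonempty
  have hd : 0 ≤ dist r s := dist_nonneg
  rw [dist_pi_le_iff (by positivity)]
  intro j
  have hTs := bwaT_mem hN Rbot Rtop R hR lam s (fun i => hp.trans_le (hcs i)) j
  have hTs' : bwaT R lam s j * ∑ i, bwaRep R lam s i = ∑ i, R i j * bwaRep R lam s i := by
    unfold bwaT; field_simp
  have key : bwaT R lam r j - bwaT R lam s j =
      (∑ i, (R i j - bwaT R lam s j) * (bwaRep R lam r i - bwaRep R lam s i)) /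
        ∑ i, bwaRep R lam r i := by
    rw [eq_div_iff hSr0.ne']
    have e1 : bwaT R lam r j * ∑ i, bwaRep R lam r i = ∑ i, R i j * bwaRep R lam r i := by
      unfold bwaT; field_simp
    rw [sub_mul, e1]
    have e2 : ∑ i, (R i j - bwaT R lam s j) * (bwaRep R lam r i - bwaRep R lam s i)
        = ∑ i, R i j * bwaRep R lam r i - ∑ i, R i j * bwaRep R lam s i
          - bwaT R lam s j * ∑ i, bwaRep R lam r i + bwaT R lam s j * ∑ i, bwaRep R lam s i := by
      rw [Finset.mul_sum, Finset.mul_sum, ← Finset.sum_sub_distrib, ← Finset.sum_sub_distrib,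
        ← Finset.sum_add_distrib]
      exact Finset.sum_congr rfl fun i _ => by ring
    rw [e2, hTs']; ring
  rw [Real.dist_eq, key, abs_div, abs_of_pos hSr0, div_le_iff₀ hSr0]
  have hnum : |∑ i, (R i j - bwaT R lam s j) * (bwaRep R lam r i - bwaRep R lam s i)| ≤
      N * ((Rtop - Rbot) * (lam * dist r s)) := by
    refine (Finset.abs_sum_le_sum_abs _ _).trans ?_
    calc _ ≤ ∑ _i : Fin N, (Rtop - Rbot) * (lam * dist r s) := by
          apply Finset.sum_le_sum
          intro i _
          rw [abs_mul]
          apply mul_le_mul _ (bwaRep_lip hM R lam hlam0 r s i) (abs_nonneg _) hΔ.le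
          rw [abs_le]
          constructor <;> linarith [(hR i j).1, (hR i j).2, hTs.1, hTs.2]
      _ = _ := by simp
  refine hnum.trans ?_
  calc _ = lam * (Rtop - Rbot) / (1 - lam * (Rtop - Rbot)) * dist r s *
        (N * (1 - lam * (Rtop - Rbot))) := by
        generalize 1 - lam * (Rtop - Rbot) = p at hp
        field_simp
    _ ≤ _ := mul_le_mul_of_nonneg_left hSr (by positivity)

/-- In the BWA rating setup with `λ ∈ [0, 1/(1+Δ))` and `Δ > 0`, the composite BWA map has a
unique fixed point `r*` with entries in `[R⊥, R⊤]`, and the BWA ranking iterates converge to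
`r*` from any starting ranking vector with entries in `[R⊥, R⊤]`. -/
theorem bwa_unique_fixed_point {N M : ℕ} (hN : 1 ≤ N) (hM : 1 ≤ M)
    (Rbot Rtop : ℝ) (hbot : 0 < Rbot) (hbt : Rbot ≤ Rtop) (htop : Rtop ≤ 1)
    (hΔ : 0 < Rtop - Rbot)
    (R : Fin N → Fin M → ℝ) (hR : ∀ (i : Fin N) (j : Fin M), Rbot ≤ R i j ∧ R i j ≤ Rtop)
    (lam : ℝ) (hlam0 : 0 ≤ lam) (hlam1 : lam < 1 / (1 + (Rtop - Rbot))) :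
    ∃ rstar : Fin M → ℝ, (∀ j : Fin M, Rbot ≤ rstar j ∧ rstar j ≤ Rtop) ∧
      bwaT R lam rstar = rstar ∧
      (∀ r : Fin M → ℝ, (∀ j : Fin M, Rbot ≤ r j ∧ r j ≤ Rtop) →
        bwaT R lam r = r → r = rstar) ∧
      (∀ r0 : Fin M → ℝ, (∀ j : Fin M, Rbot ≤ r0 j ∧ r0 j ≤ Rtop) →
        Tendsto (fun k : ℕ => (bwaT R lam)^[k] r0) atTop (𝓝 rstar)) := by
  have hlt : lam * (1 + (Rtop - Rbot)) < 1 := by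
    rwa [lt_div_iff₀ (by linarith)] at hlam1
  have h2 : lam * (Rtop - Rbot) ≤ lam := by nlinarith
  have hp : 0 < 1 - lam * (Rtop - Rbot) := by nlinarith
  have hq : 0 ≤ lam * (Rtop - Rbot) / (1 - lam * (Rtop - Rbot)) := by positivity
  set S : Set (Fin M → ℝ) := Set.Icc (fun _ => Rbot) (fun _ => Rtop) with hSdef
  have hS : ∀ r : Fin M → ℝ, r ∈ S ↔ ∀ j, Rbot ≤ r j ∧ r j ≤ Rtop := by
    intro r
    simp only [hSdef, Set.mem_Icc, Pi.le_def]
    exact forall_and.symm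
  have hmaps : Set.MapsTo (bwaT R lam) S S := by
    intro r hr
    rw [hS] at hr ⊢
    exact bwaT_mem hN Rbot Rtop R hR lam r fun i =>
      hp.trans_le (bwaRep_lower hM Rbot Rtop R hR lam hlam0 r hr i)
  have : CompleteSpace S := IsClosed.completeSpace_coe (hs := isClosed_Icc)
  have : Nonempty S := ⟨⟨fun _ => Rbot, (hS _).2 fun _ => ⟨le_rfl, hbt⟩⟩⟩
  have hK : ContractingWith (NNReal.mk _ hq) (hmaps.restrict (bwaT R lam) S S) := by
    constructor
    · apply NNReal.coe_lt_coe.1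
      change lam * (Rtop - Rbot) / (1 - lam * (Rtop - Rbot)) < 1
      rw [div_lt_one hp]
      linarith
    · apply LipschitzWith.of_dist_le_mul
      intro x y
      exact bwaT_lip hN hM Rbot Rtop hΔ R hR lam hlam0 hp x y ((hS _).1 x.2) ((hS _).1 y.2)
  have hfix : bwaT R lam (ContractingWith.fixedPoint _ hK : S) =
      (ContractingWith.fixedPoint _ hK : S) :=
    congrArg Subtype.val hK.fixedPoint_isFixedPt
  refine ⟨(ContractingWith.fixedPoint _ hK : S), (hS _).1 (Subtype.prop _), hfix, ?_, ?_⟩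
  · intro r hr h
    have : (⟨r, (hS r).2 hr⟩ : S) = ContractingWith.fixedPoint _ hK :=
      hK.fixedPoint_unique (Subtype.ext h)
    exact congrArg Subtype.val this
  · intro r0 hr0
    have h := hK.tendsto_iterate_fixedPoint ⟨r0, (hS r0).2 hr0⟩
    have h' := (continuous_subtype_val.tendsto _).comp h
    refine h'.congr fun k => ?_
    simp only [Function.comp_apply, Set.MapsTo.iterate_restrict]
    rfl
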